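/- arXiv:gr-qc/0404041 — 2 statements merged into one kernel-verified Lean document; each statement's English description precedes it below -/
import Mathlib

section
/- Suppose the so(4)-valued fields B_{0i}, Π^i (i = 1,2,3) satisfy the simplicity constraints and 𝒱 ≠ 0, and set ḡ_{kl} := ½(g^{(+1)}_{kl} + g^{(−1)}_{kl}). Then the linear map S ↦ (Σ_{i,j} G^{uvij} S_{ij})_{u,v} is an endomorphism of the 6-dimensional space of real symmetric 3×3 matrices whose determinant equals −2 𝒱⁶ (det ḡ)². Consequently this map vanishes identically in the topological sector (where ḡ = 0), and it is invertible if and only if ḡ is an invertible matrix. -/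
noncomputable section

/-- The Levi-Civita symbol on `{1,2,3}` (indexed by `Fin 3`), with `ε 0 1 2 = 1`. -/
def lev (a b c : Fin 3) : ℝ :=
  (((b.val : ℝ) - a.val) * ((c.val : ℝ) - a.val) * ((c.val : ℝ) - b.val)) / 2

/-- The sign `ε ∈ {+1, −1}` attached to the selfdual (`0`) and anti-selfdual (`1`)
labels of `so(4)`. -/
def sgn : Fin 2 → ℝ := fun ε => if ε = 0 then 1 else -1

/-- An element of `so(4)` in the selfdual/anti-selfdual basis is a family of components
`x^{(ε)a}`, `ε ∈ {+1,−1}`, `a ∈ {1,2,3}`. -/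
abbrev so4 : Type := Fin 2 → Fin 3 → ℝ

/-- The first invariant bilinear form `⟨x,y⟩ = ∑_{ε,a} x^{(ε)a} y^{(ε)a}`. -/
def ip (x y : so4) : ℝ := ∑ ε : Fin 2, ∑ a : Fin 3, x ε a * y ε a

/-- The second invariant bilinear form `≺x,y≻ = ∑_{ε,a} ε x^{(ε)a} y^{(ε)a}`. -/
def ipS (x y : so4) : ℝ := ∑ ε : Fin 2, ∑ a : Fin 3, sgn ε * x ε a * y ε a

/-- The Lie bracket of `so(4)` in the selfdual/anti-selfdual basis:
`[x,y]^{(ε)a} = ∑_{b,c} ε_{abc} x^{(ε)b} y^{(ε)c}`. -/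
def so4bracket (x y : so4) : so4 :=
  fun ε a => ∑ b : Fin 3, ∑ c : Fin 3, lev a b c * x ε b * y ε c

/-- The four-dimensional volume `𝒱 = ∑_k ≺B_{0k}, Π^k≻`. -/
def vol (B0 Pi' : Fin 3 → so4) : ℝ := ∑ k : Fin 3, ipS (B0 k) (Pi' k)

/-- The simplicity constraints: `≺B_{0i},B_{0j}≻ = 0`,
`≺B_{0j},Π^i≻ = (1/3) δ^i_j 𝒱` and `≺Π^i,Π^j≻ = 0`. -/
def Simplicity (B0 Pi' : Fin 3 → so4) : Prop :=
  (∀ i j, ipS (B0 i) (B0 j) = 0) ∧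
  (∀ i j, ipS (B0 j) (Pi' i) = if i = j then vol B0 Pi' / 3 else 0) ∧
  (∀ i j, ipS (Pi' i) (Pi' j) = 0)

/-- The spatial Urbantke metrics
`g^{(ε)}_{ij} = (1/𝒱) ∑ ε_{abc} ½(ε_{mir} B^{(ε)a}_{0j} + ε_{mjr} B^{(ε)a}_{0i}) Π^{(ε)b,m} Π^{(ε)c,r}`. -/
def urbantke (B0 Pi' : Fin 3 → so4) (ε : Fin 2) (i j : Fin 3) : ℝ :=
  (1 / vol B0 Pi') * ∑ a : Fin 3, ∑ b : Fin 3, ∑ c : Fin 3, ∑ m : Fin 3, ∑ r : Fin 3,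
    lev a b c * ((lev m i r * B0 j ε a + lev m j r * B0 i ε a) / 2) * Pi' m ε b * Pi' r ε c

/-- The Dirac-matrix block
`G^{uvij} = ¼ ∑_r ( ε^{uri}⟨Π^v,[Π^j,B_{0r}]⟩ + ε^{urj}⟨Π^v,[Π^i,B_{0r}]⟩
          + ε^{vri}⟨Π^u,[Π^j,B_{0r}]⟩ + ε^{vrj}⟨Π^u,[Π^i,B_{0r}]⟩ )`. -/
def Gtensor (B0 Pi' : Fin 3 → so4) (u v i j : Fin 3) : ℝ :=
  (1 / 4) * ∑ r : Fin 3,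
    (lev u r i * ip (Pi' v) (so4bracket (Pi' j) (B0 r)) +
     lev u r j * ip (Pi' v) (so4bracket (Pi' i) (B0 r)) +
     lev v r i * ip (Pi' u) (so4bracket (Pi' j) (B0 r)) +
     lev v r j * ip (Pi' u) (so4bracket (Pi' i) (B0 r)))

/-- The 6-dimensional real vector space of symmetric 3×3 real matrices. -/
def symMat : Submodule ℝ (Matrix (Fin 3) (Fin 3) ℝ) where
  carrier := {S | S.IsSymm}
  add_mem' := fun hS hT => hS.add hT
  zero_mem' := Matrix.isSymm_zero
  smul_mem' := fun c _ hS => hS.smul c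

@[simp] theorem lev_self_left (a b : Fin 3) : lev a a b = 0 := by
  simp [lev]

@[simp] theorem lev_self_right (a b : Fin 3) : lev a b b = 0 := by
  simp [lev]

@[simp] theorem lev_self_outer (a b : Fin 3) : lev a b a = 0 := by
  simp [lev]

theorem lev_swap_left (a b c : Fin 3) : lev b a c = -lev a b c := by
  unfold lev; ring

theorem lev_swap_right (a b c : Fin 3) : lev a c b = -lev a b c := by
  unfold lev; ring

@[simp] theorem lev_zero_one_two : lev 0 1 2 = 1 := by
  norm_num [lev]

@[simp] theorem lev_one_two_zero : lev 1 2 0 = 1 := by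
  norm_num [lev]

@[simp] theorem lev_two_zero_one : lev 2 0 1 = 1 := by
  norm_num [lev]

@[simp] theorem lev_zero_two_one : lev 0 2 1 = -1 := by
  norm_num [lev]

@[simp] theorem lev_one_zero_two : lev 1 0 2 = -1 := by
  norm_num [lev]

@[simp] theorem lev_two_one_zero : lev 2 1 0 = -1 := by
  norm_num [lev]

/-- The triple product `⟨x, [y, z]⟩` is antisymmetric in its first two arguments. -/
theorem ip_bracket_swap (x y z : so4) :
    ip y (so4bracket x z) = -ip x (so4bracket y z) := by
  simp only [ip, so4bracket, lev, Fin.sum_univ_three, Fin.sum_univ_two]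
  ring

/-- The sum over both chiralities of the Urbantke metrics, in terms of triple products. -/
theorem vol_mul_urbantke_add (B0 Pi' : Fin 3 → so4) (hV : vol B0 Pi' ≠ 0) (i j : Fin 3) :
    vol B0 Pi' * (urbantke B0 Pi' 0 i j + urbantke B0 Pi' 1 i j) =
      ∑ m : Fin 3, ∑ r : Fin 3,
        (lev m i r * ip (Pi' m) (so4bracket (Pi' r) (B0 j)) +
          lev m j r * ip (Pi' m) (so4bracket (Pi' r) (B0 i))) / 2 := by
  have key (ε : Fin 2) : vol B0 Pi' * urbantke B0 Pi' ε i j =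
      ∑ m : Fin 3, ∑ r : Fin 3, ∑ a : Fin 3, ∑ b : Fin 3, ∑ c : Fin 3,
        lev a b c * ((lev m i r * B0 j ε a + lev m j r * B0 i ε a) / 2) *
          Pi' m ε b * Pi' r ε c := by
    rw [urbantke, ← mul_assoc, mul_one_div_cancel hV, one_mul]
    simp only [Fin.sum_univ_three]
    ring
  rw [mul_add, key, key, ← Finset.sum_add_distrib]
  refine Finset.sum_congr rfl fun m _ => ?_
  rw [← Finset.sum_add_distrib]
  refine Finset.sum_congr rfl fun r _ => ?_
  generalize lev m i r = p
  generalize lev m j r = q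
  simp only [ip, so4bracket, lev, Fin.sum_univ_three, Fin.sum_univ_two]
  norm_num
  ring

/-- The polarised adjugate of `g`, in components: contracting it with a symmetric `S` gives
`∑ ε^{uri} ε^{vsj} g_{rs} S_{ij}`, averaged over the two orders of `u, v`. -/
def adjTensor (g : Matrix (Fin 3) (Fin 3) ℝ) (u v i j : Fin 3) : ℝ :=
  (1 / 4) * ∑ r : Fin 3, ∑ s : Fin 3, g r s *
    (lev u r i * lev v s j + lev u r j * lev v s i +
      lev v r i * lev u s j + lev v r j * lev u s i)

/-- A tensor antisymmetric in its first two indices is recovered from its dual. -/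
theorem eq_sum_lev_mul_dual {T : Fin 3 → Fin 3 → Fin 3 → ℝ}
    (hT : ∀ a b c, T b a c = -T a b c) (v j r : Fin 3) :
    T v j r = ∑ s, lev v j s * ((1 / 2) * ∑ a, ∑ b, lev s a b * T a b r) := by
  have h00 := hT 0 0 r
  have h11 := hT 1 1 r
  have h22 := hT 2 2 r
  have h01 := hT 0 1 r
  have h02 := hT 0 2 r
  have h12 := hT 1 2 r
  fin_cases v <;> fin_cases j <;> simp [Fin.sum_univ_three] <;> linarith

theorem Gtensor_eq (B0 Pi' : Fin 3 → so4) (hV : vol B0 Pi' ≠ 0)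
    (g : Matrix (Fin 3) (Fin 3) ℝ)
    (hg : ∀ k l, g k l = (urbantke B0 Pi' 0 k l + urbantke B0 Pi' 1 k l) / 2)
    (u v i j : Fin 3) :
    Gtensor B0 Pi' u v i j = vol B0 Pi' * adjTensor g u v i j := by
  obtain ⟨W, hW⟩ : ∃ W : Fin 3 → Fin 3 → ℝ, ∀ s r, W s r =
      (1 / 2) * ∑ a, ∑ b, lev s a b * ip (Pi' a) (so4bracket (Pi' b) (B0 r)) :=
    ⟨_, fun _ _ => rfl⟩
  have hdual (v j r : Fin 3) :
      ip (Pi' v) (so4bracket (Pi' j) (B0 r)) = -∑ s, lev v s j * W s r := by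
    rw [eq_sum_lev_mul_dual (T := fun a b c => ip (Pi' a) (so4bracket (Pi' b) (B0 c)))
      (fun a b c => ip_bracket_swap (Pi' a) (Pi' b) (B0 c)) v j r]
    simp only [← hW, lev_swap_right v _ j, neg_mul, Finset.sum_neg_distrib]
  have hVg (k l : Fin 3) : vol B0 Pi' * g k l = -(W k l + W l k) / 2 := by
    rw [hg, ← mul_div_assoc, vol_mul_urbantke_add B0 Pi' hV, hW, hW]
    simp only [lev_swap_left k, lev_swap_left l, Fin.sum_univ_three]
    ring
  have hadj : vol B0 Pi' * adjTensor g u v i j =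
      (1 / 4) * ∑ r : Fin 3, ∑ s : Fin 3, (vol B0 Pi' * g r s) *
        (lev u r i * lev v s j + lev u r j * lev v s i +
          lev v r i * lev u s j + lev v r j * lev u s i) := by
    simp only [adjTensor, Fin.sum_univ_three]
    ring
  rw [hadj]
  simp only [hVg, Gtensor, hdual, Fin.sum_univ_three]
  ring

theorem adjTensor_swap (g : Matrix (Fin 3) (Fin 3) ℝ) (u v i j : Fin 3) :
    adjTensor g v u i j = adjTensor g u v i j := by
  simp only [adjTensor, Fin.sum_univ_three]
  ring

/-- The polarised adjugate `S ↦ g × S` on symmetric matrices. -/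
def adjMap (g : Matrix (Fin 3) (Fin 3) ℝ) : symMat →ₗ[ℝ] symMat where
  toFun S := ⟨Matrix.of fun u v => ∑ i, ∑ j, adjTensor g u v i j * S.1 i j,
    Matrix.IsSymm.ext fun u v => by simp only [Matrix.of_apply, adjTensor_swap g u v]⟩
  map_add' S T := by
    ext u v
    simp [mul_add, Finset.sum_add_distrib]
  map_smul' c S := by
    ext u v
    simp [Finset.mul_sum, mul_left_comm]

theorem adjMap_apply (g : Matrix (Fin 3) (Fin 3) ℝ) (S : symMat) (u v : Fin 3) :
    (adjMap g S).1 u v = ∑ i, ∑ j, adjTensor g u v i j * S.1 i j := rfl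

/-- The diagonal and the upper off-diagonal entries as coordinates on symmetric matrices. -/
def symMatEquiv : symMat ≃ₗ[ℝ] (Fin 6 → ℝ) where
  toFun S := ![S.1 0 0, S.1 1 1, S.1 2 2, S.1 1 2, S.1 0 2, S.1 0 1]
  invFun x := ⟨!![x 0, x 5, x 4; x 5, x 1, x 3; x 4, x 3, x 2],
    Matrix.IsSymm.ext fun i j => by fin_cases i <;> fin_cases j <;> rfl⟩
  map_add' S T := by ext k; fin_cases k <;> rfl
  map_smul' c S := by ext k; fin_cases k <;> rfl
  left_inv S := by
    ext i j
    have h := S.2.apply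
    fin_cases i <;> fin_cases j <;> simp [h 0 1, h 0 2, h 1 2]
  right_inv x := by ext k; fin_cases k <;> rfl

theorem finrank_symMat : Module.finrank ℝ symMat = 6 := by
  simpa using symMatEquiv.finrank_eq

/-- The matrix of the polarised adjugate in the coordinates `symMatEquiv`. -/
def adjMatrix (g : Matrix (Fin 3) (Fin 3) ℝ) : Matrix (Fin 6) (Fin 6) ℝ :=
  !![0, g 2 2, g 1 1, -2 * g 1 2, 0, 0;
     g 2 2, 0, g 0 0, 0, -2 * g 0 2, 0;
     g 1 1, g 0 0, 0, 0, 0, -2 * g 0 1;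
     -g 1 2, 0, 0, -g 0 0, g 0 1, g 0 2;
     0, -g 0 2, 0, g 0 1, -g 1 1, g 1 2;
     0, 0, -g 0 1, g 0 2, g 1 2, -g 2 2]

theorem symMatEquiv_adjMap {g : Matrix (Fin 3) (Fin 3) ℝ} (hg : g.IsSymm) (x : Fin 6 → ℝ) :
    symMatEquiv (adjMap g (symMatEquiv.symm x)) = (adjMatrix g).mulVec x := by
  have h10 := hg.apply 0 1
  have h20 := hg.apply 0 2
  have h21 := hg.apply 1 2
  ext k
  have hS : symMatEquiv (adjMap g (symMatEquiv.symm x)) =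
      let A := (adjMap g (symMatEquiv.symm x)).1
      ![A 0 0, A 1 1, A 2 2, A 1 2, A 0 2, A 0 1] := rfl
  have hx : (symMatEquiv.symm x).1 = !![x 0, x 5, x 4; x 5, x 1, x 3; x 4, x 3, x 2] := rfl
  rw [hS]
  simp only [adjMap_apply, hx]
  fin_cases k <;>
    simp [adjTensor, adjMatrix, Matrix.mulVec, dotProduct, Fin.sum_univ_three,
      Fin.sum_univ_six, h10, h20, h21] <;> ring

theorem det_adjMatrix {g : Matrix (Fin 3) (Fin 3) ℝ} (hg : g.IsSymm) :
    (adjMatrix g).det = -2 * g.det ^ 2 := by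
  have h10 := hg.apply 0 1
  have h20 := hg.apply 0 2
  have h21 := hg.apply 1 2
  rw [Matrix.det_fin_three, h10, h20, h21]
  simp [adjMatrix, Matrix.det_succ_row_zero, Fin.sum_univ_succ, Fin.succAbove]
  ring

theorem det_adjMap {g : Matrix (Fin 3) (Fin 3) ℝ} (hg : g.IsSymm) :
    LinearMap.det (adjMap g) = -2 * g.det ^ 2 := by
  rw [← det_adjMatrix hg, ← LinearMap.det_toLin', ← LinearMap.det_conj (adjMap g) symMatEquiv]
  congr 1
  refine LinearMap.ext fun x => ?_
  simpa using symMatEquiv_adjMap hg x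

theorem urbantke_comm (B0 Pi' : Fin 3 → so4) (ε : Fin 2) (i j : Fin 3) :
    urbantke B0 Pi' ε j i = urbantke B0 Pi' ε i j := by
  simp only [urbantke, add_comm]

/-- Under the simplicity constraints with `𝒱 ≠ 0`, setting
`ḡ_{kl} = ½(g^{(+1)}_{kl} + g^{(−1)}_{kl})`, the linear map
`S ↦ (∑_{i,j} G^{uvij} S_{ij})_{u,v}` is an endomorphism of the 6-dimensional space of
real symmetric 3×3 matrices with determinant `−2 𝒱⁶ (det ḡ)²`; it vanishes identically
in the topological sector (`ḡ = 0`) and is invertible iff `ḡ` is invertible. -/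
theorem det_Gtensor_endomorphism (B0 Pi' : Fin 3 → so4)
    (hsimp : Simplicity B0 Pi') (hV : vol B0 Pi' ≠ 0)
    (gbar : Matrix (Fin 3) (Fin 3) ℝ)
    (hgbar : ∀ k l, gbar k l = (urbantke B0 Pi' 0 k l + urbantke B0 Pi' 1 k l) / 2) :
    Module.finrank ℝ symMat = 6 ∧
    ∃ Φ : symMat →ₗ[ℝ] symMat,
      (∀ S : symMat, ∀ u v : Fin 3,
        ((Φ S : Matrix (Fin 3) (Fin 3) ℝ)) u v =
          ∑ i : Fin 3, ∑ j : Fin 3,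
            Gtensor B0 Pi' u v i j * (S : Matrix (Fin 3) (Fin 3) ℝ) i j) ∧
      LinearMap.det Φ = -2 * (vol B0 Pi') ^ 6 * gbar.det ^ 2 ∧
      ((∀ k l, gbar k l = 0) → Φ = 0) ∧
      (Function.Bijective Φ ↔ IsUnit gbar) := by
  have hsymm : gbar.IsSymm := Matrix.IsSymm.ext fun i j => by
    simp only [hgbar, urbantke_comm B0 Pi' _ i j]
  have hdet : LinearMap.det (vol B0 Pi' • adjMap gbar) =
      -2 * (vol B0 Pi') ^ 6 * gbar.det ^ 2 := by
    rw [LinearMap.det_smul, finrank_symMat, det_adjMap hsymm]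
    ring
  refine ⟨finrank_symMat, vol B0 Pi' • adjMap gbar, fun S u v => ?_, hdet, fun h => ?_, ?_⟩
  · simp only [Gtensor_eq B0 Pi' hV gbar hgbar, mul_assoc, ← Finset.mul_sum]
    rfl
  · ext S u v
    simp [adjMap_apply, adjTensor, h]
  · rw [← Module.End.isUnit_iff, LinearMap.isUnit_iff_isUnit_det, hdet,
      Matrix.isUnit_iff_isUnit_det, isUnit_iff_ne_zero, isUnit_iff_ne_zero]
    simp [hV]
end
end

section
/- Suppose the so(4)-valued fields B_{0i}, Π^i (i = 1,2,3) satisfy the simplicity constraints and 𝒱 ≠ 0. Then the linear map which sends a triple (P^1, P^2, P^3) of so(4) elements (an 18-dimensional real vector space) to the tuple ( Φ(B,P), Φ(P,Π), κ₀, κ ) ∈ (traceless real 3×3 matrices) × (symmetric real 3×3 matrices) × ℝ × ℝ³, where Φ(B,P)^i_j := ⟨P^i, B_{0j}⟩ − (1/3) δ^i_j Σ_k ⟨P^k, B_{0k}⟩, Φ(P,Π)^{ij} := ½(⟨P^i, Π^j⟩ + ⟨P^j, Π^i⟩), κ₀ := Σ_i ⟨P^i, B_{0i}⟩ and κ_i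 := Σ_{j,k} ε_{ijk} ⟨P^j, Π^k⟩, is a linear bijection. -/
noncomputable section

/-- The 8-dimensional space of traceless real 3×3 matrices. -/
def tracelessMat : Submodule ℝ (Matrix (Fin 3) (Fin 3) ℝ) :=
  LinearMap.ker (Matrix.traceLinearMap (Fin 3) ℝ ℝ)

theorem ip_add_left (x y z : so4) : ip (x + y) z = ip x z + ip y z := by
  simp [ip, add_mul, Finset.sum_add_distrib]

theorem ip_smul_left (c : ℝ) (x z : so4) : ip (c • x) z = c * ip x z := by
  simp only [ip, Pi.smul_apply, smul_eq_mul, mul_assoc, Finset.mul_sum]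

theorem ipS_comm (x y : so4) : ipS x y = ipS y x := by
  simp only [ipS]
  exact Finset.sum_congr rfl fun _ _ => Finset.sum_congr rfl fun _ _ => by ring

/-- The involution of `so(4)` that intertwines the two invariant bilinear forms. -/
def signFlip (x : so4) : so4 := fun ε a => sgn ε * x ε a

theorem ip_signFlip_left (x y : so4) : ip (signFlip x) y = ipS x y := rfl

theorem ipS_add_left (x y z : so4) : ipS (x + y) z = ipS x z + ipS y z := by
  simp [ipS, mul_add, add_mul, Finset.sum_add_distrib]

theorem ipS_smul_left (c : ℝ) (x z : so4) : ipS (c • x) z = c * ipS x z := by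
  simp only [ipS, Pi.smul_apply, smul_eq_mul, Finset.mul_sum]
  exact Finset.sum_congr rfl fun _ _ => Finset.sum_congr rfl fun _ _ => by ring

/-- The components of an `so(4)` element, with respect to `⟨·,·⟩`, along `B_{0j}` and `Π^j`. -/
def componentMap (B0 Pi' : Fin 3 → so4) : so4 →ₗ[ℝ] (Fin 3 → ℝ) × (Fin 3 → ℝ) where
  toFun x := (fun j => ip x (B0 j), fun j => ip x (Pi' j))
  map_add' x y := by ext j <;> simp [ip_add_left]
  map_smul' c x := by ext j <;> simp [ip_smul_left]

theorem componentMap_surjective {B0 Pi' : Fin 3 → so4}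
    (hsimp : Simplicity B0 Pi') (hV : vol B0 Pi' ≠ 0) :
    Function.Surjective (componentMap B0 Pi') := by
  obtain ⟨hBB, hBP, hPP⟩ := hsimp
  rintro ⟨b, p⟩
  have hPB (i j) : ipS (Pi' i) (B0 j) = if i = j then vol B0 Pi' / 3 else 0 := by
    rw [ipS_comm, hBP]
  refine ⟨signFlip ((3 / vol B0 Pi') •
    ((p 0 • B0 0 + p 1 • B0 1 + p 2 • B0 2) + (b 0 • Pi' 0 + b 1 • Pi' 1 + b 2 • Pi' 2))), ?_⟩
  refine Prod.ext ?_ ?_ <;> funext j <;>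
    simp only [componentMap, LinearMap.coe_mk, AddHom.coe_mk, ip_signFlip_left,
      ipS_add_left, ipS_smul_left, hBB, hPB, hBP, hPP] <;>
    fin_cases j <;> simp <;> field_simp

theorem componentMap_injective {B0 Pi' : Fin 3 → so4}
    (hsimp : Simplicity B0 Pi') (hV : vol B0 Pi' ≠ 0) :
    Function.Injective (componentMap B0 Pi') :=
  (LinearMap.injective_iff_surjective_of_finrank_eq_finrank (by simp [Module.finrank_pi_fintype])).2
    (componentMap_surjective hsimp hV)

/-- The map `P ↦ (Φ(B,P), Φ(P,Π), κ₀, κ)`. -/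
def momentumMap (B0 Pi' : Fin 3 → so4) :
    (Fin 3 → so4) →ₗ[ℝ] (tracelessMat × symMat × ℝ × (Fin 3 → ℝ)) where
  toFun P :=
    (⟨Matrix.of fun i j => ip (P i) (B0 j) -
        (1 / 3) * (if i = j then (1 : ℝ) else 0) * ∑ k : Fin 3, ip (P k) (B0 k), by
        simp [tracelessMat, Matrix.trace, Fin.sum_univ_three]⟩,
      ⟨Matrix.of fun i j => (ip (P i) (Pi' j) + ip (P j) (Pi' i)) / 2,
        Matrix.IsSymm.ext fun i j => by simp [add_comm]⟩,
      ∑ i : Fin 3, ip (P i) (B0 i),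
      fun i => ∑ j : Fin 3, ∑ k : Fin 3, lev i j k * ip (P j) (Pi' k))
  map_add' P Q := by
    refine Prod.ext (Subtype.ext ?_) (Prod.ext (Subtype.ext ?_) (Prod.ext ?_ ?_))
    · ext i j
      simp [ip_add_left, Finset.sum_add_distrib]
      split_ifs <;> ring
    · ext i j
      simp [ip_add_left]; ring
    · simp [ip_add_left, Finset.sum_add_distrib]
    · ext i
      simp [ip_add_left, Finset.sum_add_distrib, mul_add]
  map_smul' c P := by
    refine Prod.ext (Subtype.ext ?_) (Prod.ext (Subtype.ext ?_) (Prod.ext ?_ ?_))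
    · ext i j
      simp [ip_smul_left, ← Finset.mul_sum]
      split_ifs <;> ring
    · ext i j
      simp [ip_smul_left]; ring
    · simp [ip_smul_left, Finset.mul_sum]
    · ext i
      simp [ip_smul_left, Finset.mul_sum, mul_left_comm]

theorem momentumMap_injective {B0 Pi' : Fin 3 → so4}
    (hsimp : Simplicity B0 Pi') (hV : vol B0 Pi' ≠ 0) :
    Function.Injective (momentumMap B0 Pi') := by
  refine (injective_iff_map_eq_zero _).2 fun P hP => ?_
  have hA (i j) := congrFun₂ (congrArg (fun t => (t.1 : Matrix (Fin 3) (Fin 3) ℝ)) hP) i j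
  have hS (i j) := congrFun₂ (congrArg (fun t => (t.2.1 : Matrix (Fin 3) (Fin 3) ℝ)) hP) i j
  have hc := congrArg (fun t => t.2.2.1) hP
  have hk (i) := congrFun (congrArg (fun t => t.2.2.2) hP) i
  simp only [momentumMap, LinearMap.coe_mk, AddHom.coe_mk, Matrix.of_apply, Prod.fst_zero,
    Prod.snd_zero, ZeroMemClass.coe_zero, Matrix.zero_apply, Pi.zero_apply] at hA hS hc hk
  have hB (i j) : ip (P i) (B0 j) = 0 := by simpa [hc] using hA i j
  have hk0 := hk 0
  have hk1 := hk 1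
  have hk2 := hk 2
  have hPi (i j) : ip (P i) (Pi' j) = 0 := by
    have hij := hS i j
    norm_num [lev, Fin.sum_univ_three] at hk0 hk1 hk2
    fin_cases i <;> fin_cases j <;> simp at hij ⊢ <;> linarith
  funext i
  refine componentMap_injective hsimp hV ?_
  rw [Pi.zero_apply, map_zero]
  exact Prod.ext (funext (hB i)) (funext (hPi i))

theorem momentumMap_surjective {B0 Pi' : Fin 3 → so4}
    (hsimp : Simplicity B0 Pi') (hV : vol B0 Pi' ≠ 0) :
    Function.Surjective (momentumMap B0 Pi') := by
  rintro ⟨⟨A, hA⟩, ⟨S, hS⟩, c, κ⟩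
  choose P hP using fun i : Fin 3 => componentMap_surjective hsimp hV
    (fun j => A i j + if i = j then c / 3 else 0,
      fun j => S i j + (∑ k : Fin 3, lev k i j * κ k) / 2)
  have hB (i j) : ip (P i) (B0 j) = A i j + if i = j then c / 3 else 0 :=
    congrFun (congrArg Prod.fst (hP i)) j
  have hPi (i j) : ip (P i) (Pi' j) = S i j + (∑ k : Fin 3, lev k i j * κ k) / 2 :=
    congrFun (congrArg Prod.snd (hP i)) j
  have htr : A 0 0 + A 1 1 + A 2 2 = 0 := by
    simpa [tracelessMat, Matrix.trace, Fin.sum_univ_three] using hA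
  have hsym (i j) : S j i = S i j := Matrix.IsSymm.apply hS i j
  have hc : ∑ k : Fin 3, ip (P k) (B0 k) = c := by
    simp only [hB, Fin.sum_univ_three, if_true]
    linarith
  refine ⟨P, Prod.ext (Subtype.ext ?_) (Prod.ext (Subtype.ext ?_) (Prod.ext hc ?_))⟩
  · ext i j
    simp only [momentumMap, LinearMap.coe_mk, AddHom.coe_mk, Matrix.of_apply, hc]
    rw [hB]
    split_ifs <;> ring
  · ext i j
    have hlev (k) : lev k j i = -lev k i j := by simp only [lev]; ring
    simp only [momentumMap, LinearMap.coe_mk, AddHom.coe_mk, Matrix.of_apply, hPi, hsym i j, hlev,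
      neg_mul, Finset.sum_neg_distrib]
    ring
  · ext i
    simp only [momentumMap, LinearMap.coe_mk, AddHom.coe_mk, hPi]
    have h01 := hsym 0 1
    have h02 := hsym 0 2
    have h12 := hsym 1 2
    match i with
    | 0 | 1 | 2 => norm_num [lev, Fin.sum_univ_three]; linarith

/-- Under the simplicity constraints with `𝒱 ≠ 0`, the linear map sending a triple
`(P^1,P^2,P^3)` of `so(4)` elements to
`(Φ(B,P), Φ(P,Π), κ₀, κ)` — with `Φ(B,P)^i_j = ⟨P^i,B_{0j}⟩ − ⅓ δ^i_j ∑_k ⟨P^k,B_{0k}⟩`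
traceless, `Φ(P,Π)^{ij} = ½(⟨P^i,Π^j⟩+⟨P^j,Π^i⟩)` symmetric,
`κ₀ = ∑_i ⟨P^i,B_{0i}⟩` and `κ_i = ∑_{j,k} ε_{ijk} ⟨P^j,Π^k⟩` — is a linear bijection
from the 18-dimensional space of triples onto
(traceless 3×3) × (symmetric 3×3) × ℝ × ℝ³. -/
theorem momentum_change_of_variables_bijective (B0 Pi' : Fin 3 → so4)
    (hsimp : Simplicity B0 Pi') (hV : vol B0 Pi' ≠ 0) :
    ∃ Φ : (Fin 3 → so4) →ₗ[ℝ] (tracelessMat × symMat × ℝ × (Fin 3 → ℝ)),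
      (∀ P : Fin 3 → so4,
        (∀ i j : Fin 3, ((Φ P).1 : Matrix (Fin 3) (Fin 3) ℝ) i j =
          ip (P i) (B0 j) -
            (1 / 3) * (if i = j then (1 : ℝ) else 0) * ∑ k : Fin 3, ip (P k) (B0 k)) ∧
        (∀ i j : Fin 3, ((Φ P).2.1 : Matrix (Fin 3) (Fin 3) ℝ) i j =
          (ip (P i) (Pi' j) + ip (P j) (Pi' i)) / 2) ∧
        ((Φ P).2.2.1 = ∑ i : Fin 3, ip (P i) (B0 i)) ∧
        (∀ i : Fin 3, (Φ P).2.2.2 i =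
          ∑ j : Fin 3, ∑ k : Fin 3, lev i j k * ip (P j) (Pi' k))) ∧
      Function.Bijective Φ := by
  exact ⟨momentumMap B0 Pi', fun P => ⟨fun _ _ => rfl, fun _ _ => rfl, rfl, fun _ => rfl⟩,
    momentumMap_injective hsimp hV, momentumMap_surjective hsimp hV⟩
end
end
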